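/- Let k ∈ ℕ_0 and let S_a be a convergent subdivision scheme with dilation mI, |m| ≥ 2, with symbol a(z) and parameter values t^{(r)}_α = α/m^r − τ Σ_{i=1}^r m^{−i} for some τ ∈ ℝ^s. If (D^j a)(1,…,1) = |m|^s q_j(τ) and (D^j a)(ε) = 0 for every ε ∈ Ξ′ and every multi-index j ∈ ℕ_0^s with |j| ≤ k, then S_a reproduces polynomials of total degree up to k. -/

import Mathlib

open Finset Filter

noncomputable section

/-- Sequences indexed by `ℤ^s`. -/
abbrev ZS (s : ℕ) := Fin s → ℤ

/-- `z^α = z_1^{α_1} ⋯ z_s^{α_s}` for `z ∈ ℂ^s`, `α ∈ ℤ^s`. -/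
def zpowV {s : ℕ} (z : Fin s → ℂ) (α : Fin s → ℤ) : ℂ := ∏ i, z i ^ α i

/-- The tensor-product falling factorial polynomial
`q_j(x) = ∏_i ∏_{ℓ=0}^{j_i-1} (x_i - ℓ)` (complex version). -/
def qpolyC {s : ℕ} (j : Fin s → ℕ) (x : Fin s → ℂ) : ℂ :=
  ∏ i, ∏ l ∈ Finset.range (j i), (x i - l)

/-- The tensor-product falling factorial polynomial (real version). -/
def qpolyR {s : ℕ} (j : Fin s → ℕ) (x : Fin s → ℝ) : ℝ :=
  ∏ i, ∏ l ∈ Finset.range (j i), (x i - l)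

/-- `(D^j a)(z) = ∑_α q_j(α) a_α z^{α-j}`, the `j`-th iterated partial derivative of the symbol
`a(z) = ∑_α a_α z^α`.  For `j = 0` this is the symbol itself. -/
def symbolD {s : ℕ} (a : ZS s → ℝ) (j : Fin s → ℕ) (z : Fin s → ℂ) : ℂ :=
  ∑ᶠ α : ZS s, qpolyC j (fun i => (α i : ℂ)) * (a α : ℂ) * zpowV z (fun i => α i - (j i : ℤ))

/-- The point `(1,…,1) ∈ ℂ^s`. -/
def onesC {s : ℕ} : Fin s → ℂ := fun _ => 1

/-- `e ∈ E = {0,…,|m|-1}^s`. -/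
def inE {s : ℕ} (m : ℤ) (e : ZS s) : Prop := ∀ i, 0 ≤ e i ∧ e i < |m|

/-- `ε_e = (e^{-2πi e_1/m}, …, e^{-2πi e_s/m}) ∈ ℂ^s`. -/
def epsPt {s : ℕ} (m : ℤ) (e : ZS s) : Fin s → ℂ :=
  fun i => Complex.exp (-(2 * Real.pi * Complex.I * e i) / m)

/-- The subdivision operator `(S_a d)_α = ∑_β a_{α-mβ} d_β`. -/
def subdOp {s : ℕ} (m : ℤ) (a : ZS s → ℝ) (d : ZS s → ℝ) : ZS s → ℝ :=
  fun α => ∑ᶠ β : ZS s, a (α - m • β) * d β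

/-- The parameter values `t^{(r)}_α = α/m^r - τ ∑_{i=1}^r m^{-i}` attached to the data at
level `r`. -/
def param {s : ℕ} (m : ℤ) (τ : Fin s → ℝ) (r : ℕ) (α : ZS s) : Fin s → ℝ :=
  fun i => (α i : ℝ) / (m : ℝ) ^ r - τ i * ∑ n ∈ Finset.range r, ((m : ℝ) ^ (n + 1))⁻¹

/-- The subdivision scheme `S_a` (with dilation `mI` and parametrization offset `τ`) converges
from initial data `d` to the limit `g`: there are continuous functions `F^{(r)}` interpolating
the data `S_a^r d` at the parameter values `t^{(r)}`, converging uniformly to `g`. -/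
def ConvergesTo {s : ℕ} (m : ℤ) (a : ZS s → ℝ) (τ : Fin s → ℝ)
    (d : ZS s → ℝ) (g : (Fin s → ℝ) → ℝ) : Prop :=
  ∃ F : ℕ → (Fin s → ℝ) → ℝ,
    (∀ r, Continuous (F r)) ∧
    (∀ r α, F r (param m τ r α) = (subdOp m a)^[r] d α) ∧
    TendstoUniformly F g atTop

/-- Bounded data. -/
def Bdd {s : ℕ} (d : ZS s → ℝ) : Prop := ∃ C, ∀ α, |d α| ≤ C

/-- The subdivision scheme is convergent: every bounded initial data admits a limit. -/
def Convergent {s : ℕ} (m : ℤ) (a : ZS s → ℝ) (τ : Fin s → ℝ) : Prop :=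
  ∀ d, Bdd d → ∃ g, ConvergesTo m a τ d g

/-- The subdivision scheme is non-singular: it is convergent and a zero limit forces zero data. -/
def NonSingular {s : ℕ} (m : ℤ) (a : ZS s → ℝ) (τ : Fin s → ℝ) : Prop :=
  Convergent m a τ ∧
  ∀ d, Bdd d → ∀ g, ConvergesTo m a τ d g → g = 0 → (∀ α, d α = 0)

/-- `S_a` reproduces polynomials up to degree `k`: for every `s`-variate real polynomial `π` of
total degree at most `k`, the scheme converges from the data `(π(α))_α` to the limit `π`. -/
def Reproduces {s : ℕ} (m : ℤ) (a : ZS s → ℝ) (τ : Fin s → ℝ) (k : ℕ) : Prop :=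
  ∀ π : MvPolynomial (Fin s) ℝ, π.totalDegree ≤ k →
    ConvergesTo m a τ (fun α => MvPolynomial.eval (fun i => (α i : ℝ)) π)
      (fun x => MvPolynomial.eval x π)

/-- `S_a` is step-wise polynomial reproducing up to degree `k`:
`S_a (π(t^{(r)}_·)) = π(t^{(r+1)}_·)` for every polynomial `π` of total degree at most `k`. -/
def StepwiseReproduces {s : ℕ} (m : ℤ) (a : ZS s → ℝ) (τ : Fin s → ℝ) (k : ℕ) : Prop :=
  ∀ π : MvPolynomial (Fin s) ℝ, π.totalDegree ≤ k → ∀ r : ℕ, ∀ α : ZS s,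
    subdOp m a (fun β => MvPolynomial.eval (param m τ r β) π) α
      = MvPolynomial.eval (param m τ (r + 1) α) π

/-- Condition `Z_k`: `a(1,…,1) = |m|^s` and `(D^j a)(ε) = 0` for all `ε ∈ Ξ'` and `|j| < k`. -/
def CondZ {s : ℕ} (m : ℤ) (a : ZS s → ℝ) (k : ℕ) : Prop :=
  symbolD a 0 onesC = ((|m| : ℤ) : ℂ) ^ s ∧
  ∀ e : ZS s, inE m e → e ≠ 0 → ∀ j : Fin s → ℕ, (∑ i, j i) < k →
    symbolD a j (epsPt m e) = 0

theorem sum_exp_zpow {m : ℤ} (hm : m ≠ 0) (δ : ℤ) :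
    ∑ n ∈ Finset.range m.natAbs,
      Complex.exp (-(2 * Real.pi * Complex.I * ((n : ℤ) : ℂ)) / m) ^ δ
      = if m ∣ δ then ((|m| : ℤ) : ℂ) else 0 := by
  have hmC : (m : ℂ) ≠ 0 := by exact_mod_cast hm
  have hpi : (2 * Real.pi * Complex.I : ℂ) ≠ 0 := Complex.two_pi_I_ne_zero
  set w := Complex.exp (-(2 * Real.pi * Complex.I * δ) / m) with hw
  have hterm : ∀ n ∈ Finset.range m.natAbs,
      Complex.exp (-(2 * Real.pi * Complex.I * ((n : ℤ) : ℂ)) / m) ^ δ = w ^ n := by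
    intro n _
    rw [hw, ← Complex.exp_int_mul, ← Complex.exp_nat_mul]
    congr 1
    push_cast
    ring
  have hw1 : w = 1 ↔ m ∣ δ := by
    rw [hw, Complex.exp_eq_one_iff]
    constructor
    · rintro ⟨n, hn⟩
      refine ⟨-n, ?_⟩
      have h : (2 * Real.pi * Complex.I : ℂ) * δ = (2 * Real.pi * Complex.I) * (m * -n) := by
        field_simp at hn
        linear_combination (-2 * Real.pi * Complex.I : ℂ) * hn
      exact_mod_cast mul_left_cancel₀ hpi h
    · rintro ⟨n, rfl⟩
      refine ⟨-n, ?_⟩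
      push_cast
      field_simp
  rw [Finset.sum_congr rfl hterm]
  split_ifs with h
  · rw [hw1.2 h]
    simp
  · have hne : w ≠ 1 := fun h' => h (hw1.1 h')
    have hpow : w ^ m.natAbs = 1 := by
      rw [← zpow_natCast, Int.natCast_natAbs]
      have hwm : w ^ m = 1 := by
        rw [hw, ← Complex.exp_int_mul, Complex.exp_eq_one_iff]
        refine ⟨-δ, ?_⟩
        push_cast
        field_simp
      rcases abs_choice m with h' | h' <;> simp [h', hwm]
    rw [geom_sum_eq hne, hpow]
    simp

/-- The set `E = {0,…,|m|-1}^s` as a finset. -/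
def boxE (s : ℕ) (m : ℤ) : Finset (ZS s) :=
  Fintype.piFinset fun _ => (Finset.range m.natAbs).map Nat.castEmbedding

theorem mem_boxE {s : ℕ} {m : ℤ} {e : ZS s} : e ∈ boxE s m ↔ inE m e := by
  simp only [boxE, Fintype.mem_piFinset, Finset.mem_map, Finset.mem_range, Nat.castEmbedding_apply,
    inE, Int.abs_eq_natAbs]
  refine forall_congr' fun i => ⟨?_, fun h => ⟨(e i).toNat, by omega, by omega⟩⟩
  rintro ⟨n, hn, h⟩
  omega

theorem sum_boxE_zpowV {s : ℕ} {m : ℤ} (hm : m ≠ 0) (δ : ZS s) :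
    ∑ e ∈ boxE s m, zpowV (epsPt m e) δ
      = if ∀ i, m ∣ δ i then ((|m| : ℤ) : ℂ) ^ s else 0 := by
  simp only [zpowV, epsPt, boxE]
  rw [← Finset.prod_univ_sum (fun _ : Fin s => (Finset.range m.natAbs).map Nat.castEmbedding)
    (fun i (n : ℤ) => Complex.exp (-(2 * Real.pi * Complex.I * n) / m) ^ δ i)]
  simp only [Finset.sum_map, Nat.castEmbedding_apply, sum_exp_zpow hm]
  rw [Finset.prod_ite_zero]
  simp

theorem zpowV_add {s : ℕ} {z : Fin s → ℂ} (hz : ∀ i, z i ≠ 0) (α β : ZS s) :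
    zpowV z (α + β) = zpowV z α * zpowV z β := by
  simp only [zpowV, ← Finset.prod_mul_distrib, Pi.add_apply]
  exact Finset.prod_congr rfl fun i _ => zpow_add₀ (hz i) _ _

theorem epsPt_zero {s : ℕ} (m : ℤ) : epsPt m (0 : ZS s) = onesC := by
  funext i
  simp [epsPt, onesC]

theorem symbolD_eq_sum {s : ℕ} {a : ZS s → ℝ} (ha : (Function.support a).Finite)
    (j : Fin s → ℕ) (z : Fin s → ℂ) :
    symbolD a j z = ∑ γ ∈ ha.toFinset,
      qpolyC j (fun i => (γ i : ℂ)) * (a γ : ℂ) * zpowV z (fun i => γ i - (j i : ℤ)) := by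
  refine finsum_eq_sum_of_support_subset _ fun γ hγ => ?_
  simp only [Set.Finite.coe_toFinset, Function.mem_support] at hγ ⊢
  rintro h
  simp [h] at hγ

theorem ofReal_qpolyR {s : ℕ} (j : Fin s → ℕ) (x : Fin s → ℝ) :
    (qpolyR j x : ℂ) = qpolyC j (fun i => (x i : ℂ)) := by
  simp [qpolyR, qpolyC]

open Classical in
/-- The symbol conditions give the moments of every residue class of the mask. -/
theorem sum_residue_class_qpolyR {s : ℕ} {m : ℤ} (hm : m ≠ 0) {a : ZS s → ℝ}
    (ha : (Function.support a).Finite) {τ : Fin s → ℝ} {j : Fin s → ℕ}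
    (h_ones : symbolD a j onesC = ((|m| : ℤ) : ℂ) ^ s * qpolyC j (fun i => (τ i : ℂ)))
    (h_eps : ∀ e : ZS s, inE m e → e ≠ 0 → symbolD a j (epsPt m e) = 0) (α : ZS s) :
    ∑ γ ∈ ha.toFinset, (if ∀ i, m ∣ γ i - α i then a γ else 0) * qpolyR j (fun i => (γ i : ℝ))
      = qpolyR j τ := by
  have hC : ((|m| : ℤ) : ℂ) ^ s ≠ 0 := pow_ne_zero _ (by exact_mod_cast abs_ne_zero.2 hm)
  let ρ : ZS s := fun i => (j i : ℤ) - α i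
  have hleft : ∑ e ∈ boxE s m, zpowV (epsPt m e) ρ * symbolD a j (epsPt m e)
      = ((|m| : ℤ) : ℂ) ^ s * qpolyC j (fun i => (τ i : ℂ)) := by
    rw [Finset.sum_eq_single_of_mem (0 : ZS s)
      (mem_boxE.2 fun i => ⟨le_rfl, abs_pos.2 hm⟩), epsPt_zero, h_ones]
    · simp [zpowV, onesC]
    · intro e he hne
      rw [h_eps e (mem_boxE.1 he) hne, mul_zero]
  have hright : ∑ e ∈ boxE s m, zpowV (epsPt m e) ρ * symbolD a j (epsPt m e)
      = ((|m| : ℤ) : ℂ) ^ s * ∑ γ ∈ ha.toFinset,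
          (if ∀ i, m ∣ γ i - α i then (a γ : ℂ) else 0) * qpolyC j (fun i => (γ i : ℂ)) := by
    simp only [symbolD_eq_sum ha, Finset.mul_sum]
    rw [Finset.sum_comm]
    refine Finset.sum_congr rfl fun γ _ => ?_
    have hz : ∀ e : ZS s, zpowV (epsPt m e) ρ * (qpolyC j (fun i => (γ i : ℂ)) * (a γ : ℂ) *
        zpowV (epsPt m e) (fun i => γ i - (j i : ℤ)))
        = qpolyC j (fun i => (γ i : ℂ)) * (a γ : ℂ) * zpowV (epsPt m e) (γ - α) := by
      intro e
      have hsum : γ - α = ρ + fun i => γ i - (j i : ℤ) := by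
        funext i
        simp only [ρ, Pi.sub_apply, Pi.add_apply]
        ring
      rw [hsum, zpowV_add (z := epsPt m e) fun i => Complex.exp_ne_zero _]
      ring
    simp only [hz, ← Finset.mul_sum, sum_boxE_zpowV hm, Pi.sub_apply]
    split_ifs <;> ring
  have key := mul_left_cancel₀ hC (hright.symm.trans hleft)
  apply Complex.ofReal_injective
  rw [ofReal_qpolyR, ← key]
  push_cast [ofReal_qpolyR]
  refine Finset.sum_congr rfl fun γ _ => ?_
  split_ifs <;> simp

/-- The span of the falling factorial polynomials `q_j` with `|j| ≤ n`. -/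
def qspan (s n : ℕ) : Submodule ℝ ((Fin s → ℝ) → ℝ) :=
  Submodule.span ℝ {f | ∃ j : Fin s → ℕ, (∑ i, j i) ≤ n ∧ f = qpolyR j}

theorem qspan_mono {s n n' : ℕ} (h : n ≤ n') : qspan s n ≤ qspan s n' :=
  Submodule.span_mono fun _ ⟨j, hj, hf⟩ => ⟨j, hj.trans h, hf⟩

theorem coord_mul_qpolyR {s : ℕ} (i : Fin s) (j : Fin s → ℕ) :
    (fun x : Fin s → ℝ => x i * qpolyR j x)
      = qpolyR (j + Pi.single i 1) + (j i : ℝ) • qpolyR j := by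
  funext x
  have h : qpolyR (j + Pi.single i 1) x = (x i - j i) * qpolyR j x := by
    simp only [qpolyR]
    rw [← Finset.mul_prod_erase _ _ (Finset.mem_univ i),
      ← Finset.mul_prod_erase _ (fun i => ∏ l ∈ Finset.range (j i), (x i - l))
        (Finset.mem_univ i)]
    have hrest : ∀ i' ∈ Finset.univ.erase i,
        ∏ l ∈ Finset.range ((j + Pi.single i 1 : Fin s → ℕ) i'), (x i' - l)
          = ∏ l ∈ Finset.range (j i'), (x i' - l) := by
      intro i' hi'
      simp [Pi.single_eq_of_ne (Finset.ne_of_mem_erase hi')]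
    rw [Finset.prod_congr rfl hrest]
    simp only [Pi.add_apply, Pi.single_eq_same, Finset.prod_range_succ]
    ring
  simp only [Pi.add_apply, Pi.smul_apply, smul_eq_mul, h]
  ring

theorem coord_mul_mem_qspan {s n : ℕ} (i : Fin s) {f : (Fin s → ℝ) → ℝ} (hf : f ∈ qspan s n) :
    (fun x => x i * f x) ∈ qspan s (n + 1) := by
  induction hf using Submodule.span_induction with
  | mem f hf =>
    obtain ⟨j, hj, rfl⟩ := hf
    rw [coord_mul_qpolyR]
    refine Submodule.add_mem _ (Submodule.subset_span ⟨_, ?_, rfl⟩)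
      (Submodule.smul_mem _ _ (Submodule.subset_span ⟨j, hj.trans n.le_succ, rfl⟩))
    simpa [Finset.sum_add_distrib] using hj
  | zero =>
    convert (qspan s (n + 1)).zero_mem using 1
    funext x
    simp
  | add f g _ _ hf hg =>
    convert Submodule.add_mem _ hf hg using 1
    funext x
    simp [mul_add]
  | smul c f _ hf =>
    convert Submodule.smul_mem _ c hf using 1
    funext x
    simp [mul_left_comm]

theorem affine_mul_mem_qspan {s n : ℕ} (i : Fin s) (c b : ℝ) {f : (Fin s → ℝ) → ℝ}
    (hf : f ∈ qspan s n) : (fun x => (c * x i + b) * f x) ∈ qspan s (n + 1) := by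
  convert Submodule.add_mem _ (Submodule.smul_mem _ c (coord_mul_mem_qspan i hf))
    (Submodule.smul_mem _ b (qspan_mono n.le_succ hf)) using 1
  funext x
  simp [add_mul, mul_assoc]

theorem affine_monomial_mem_qspan {s : ℕ} (c b : Fin s → ℝ) (n : ℕ) (d : Fin s → ℕ)
    (hd : ∑ i, d i = n) : (fun x : Fin s → ℝ => ∏ i, (c i * x i + b i) ^ d i) ∈ qspan s n := by
  induction n generalizing d with
  | zero =>
    have h0 : ∀ i, d i = 0 := by simpa using hd
    refine Submodule.subset_span ⟨0, by simp, ?_⟩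
    funext x
    simp [qpolyR, h0]
  | succ n ih =>
    obtain ⟨i, hi⟩ : ∃ i, d i ≠ 0 := by
      by_contra! h
      simp [h] at hd
    have hdi : d = Function.update d i (d i - 1) + Pi.single i 1 := by
      funext i'
      rcases eq_or_ne i' i with rfl | h
      · simp; omega
      · simp [h]
    set d' := Function.update d i (d i - 1)
    have hd' : ∑ i, d' i = n := by
      rw [hdi] at hd
      simpa [Finset.sum_add_distrib] using hd
    convert affine_mul_mem_qspan i (c i) (b i) (ih d' hd') using 1
    funext x
    rw [hdi]
    simp only [Pi.add_apply, pow_add, Finset.prod_mul_distrib, mul_comm (c i * x i + b i)]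
    congr 1
    rw [Finset.prod_eq_single i] <;> simp +contextual

theorem eval_affine_mem_qspan {s k : ℕ} (c b : Fin s → ℝ) {π : MvPolynomial (Fin s) ℝ}
    (hπ : π.totalDegree ≤ k) :
    (fun x : Fin s → ℝ => MvPolynomial.eval (fun i => c i * x i + b i) π) ∈ qspan s k := by
  have h : (fun x : Fin s → ℝ => MvPolynomial.eval (fun i => c i * x i + b i) π)
      = ∑ d ∈ π.support, π.coeff d • fun x : Fin s → ℝ => ∏ i, (c i * x i + b i) ^ d i := by
    funext x
    simp [MvPolynomial.eval_eq']
  rw [h]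
  refine Submodule.sum_mem _ fun d hd => Submodule.smul_mem _ _ ?_
  refine qspan_mono ((MvPolynomial.le_totalDegree hd).trans hπ)
    (affine_monomial_mem_qspan c b _ d ?_)
  rw [Finsupp.sum_fintype _ _ fun _ => rfl]

/-- A functional `∑ w_γ δ_γ` that agrees with evaluation at `τ` on the `q_j`, `|j| ≤ n`, agrees
with it on their span. -/
theorem sum_mul_eq_of_mem_qspan {s n : ℕ} {T : Finset (ZS s)} {w : ZS s → ℝ} {τ : Fin s → ℝ}
    (hw : ∀ j : Fin s → ℕ, (∑ i, j i) ≤ n →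
      ∑ γ ∈ T, w γ * qpolyR j (fun i => (γ i : ℝ)) = qpolyR j τ)
    {f : (Fin s → ℝ) → ℝ} (hf : f ∈ qspan s n) :
    ∑ γ ∈ T, w γ * f (fun i => (γ i : ℝ)) = f τ := by
  induction hf using Submodule.span_induction with
  | mem f hf =>
    obtain ⟨j, hj, rfl⟩ := hf
    exact hw j hj
  | zero => simp
  | add f g _ _ hf hg => simp [mul_add, Finset.sum_add_distrib, hf, hg]
  | smul c f _ hf => simp [mul_left_comm _ c, ← Finset.mul_sum, hf]

open Classical in
theorem subdOp_eq_sum {s : ℕ} {m : ℤ} (hm : m ≠ 0) {a : ZS s → ℝ}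
    (ha : (Function.support a).Finite) (f : (Fin s → ℝ) → ℝ) (α : ZS s) :
    subdOp m a (fun β => f fun i => (β i : ℝ)) α
      = ∑ γ ∈ ha.toFinset, (if ∀ i, m ∣ γ i - α i then a γ else 0) *
          f (fun i => ((α i : ℝ) - γ i) / m) := by
  have hmR : (m : ℝ) ≠ 0 := by exact_mod_cast hm
  let g : ZS s → ZS s := fun β => α - m • β
  have hg : Function.Injective g := by
    intro β β' h
    funext i
    simpa [g, hm] using congrFun h i
  have hrange : ∀ γ, γ ∈ Set.range g ↔ ∀ i, m ∣ γ i - α i := by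
    intro γ
    constructor
    · rintro ⟨β, rfl⟩ i
      simp [g]
    · intro h
      choose β hβ using h
      refine ⟨fun i => -β i, ?_⟩
      funext i
      simp only [g, Pi.sub_apply, Pi.smul_apply, smul_eq_mul]
      linarith [hβ i]
  have hsub : ∀ β : ZS s, a (α - m • β) * f (fun i => (β i : ℝ))
      = a (g β) * f (fun i => ((α i : ℝ) - g β i) / m) := by
    intro β
    congr 2
    funext i
    simp only [g, Pi.sub_apply, Pi.smul_apply, smul_eq_mul]
    push_cast
    field_simp
    ring
  simp only [subdOp, hsub]
  rw [← finsum_mem_range (f := fun γ : ZS s => a γ * f fun i => ((α i : ℝ) - γ i) / m) hg,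
    finsum_mem_def, finsum_eq_sum_of_support_subset (s := ha.toFinset)]
  · refine Finset.sum_congr rfl fun γ _ => ?_
    simp only [Set.indicator_apply, hrange]
    split_ifs <;> simp
  · intro γ hγ
    simp only [Set.Finite.coe_toFinset, Function.mem_support, Set.indicator_apply] at hγ ⊢
    rintro h
    simp [h] at hγ

theorem stepwiseReproduces_of_symbolD {s : ℕ} {m : ℤ} (hm : m ≠ 0) {a : ZS s → ℝ}
    (ha : (Function.support a).Finite) {k : ℕ} {τ : Fin s → ℝ}
    (hcond : ∀ j : Fin s → ℕ, (∑ i, j i) ≤ k →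
      symbolD a j onesC = ((|m| : ℤ) : ℂ) ^ s * qpolyC j (fun i => (τ i : ℂ)) ∧
      ∀ e : ZS s, inE m e → e ≠ 0 → symbolD a j (epsPt m e) = 0) :
    StepwiseReproduces m a τ k := by
  classical
  intro π hπ r α
  have hmR : (m : ℝ) ≠ 0 := by exact_mod_cast hm
  let σ : ℝ := ∑ n ∈ Finset.range r, ((m : ℝ) ^ (n + 1))⁻¹
  let c : Fin s → ℝ := fun _ => -((m : ℝ) ^ (r + 1))⁻¹
  let b : Fin s → ℝ := fun i => α i * ((m : ℝ) ^ (r + 1))⁻¹ - τ i * σ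
  have hsum := subdOp_eq_sum hm ha
    (fun x => MvPolynomial.eval (fun i => x i / (m : ℝ) ^ r - τ i * σ) π) α
  have harg : ∀ γ : ZS s, (fun i => ((α i : ℝ) - γ i) / m / (m : ℝ) ^ r - τ i * σ)
      = fun i => c i * (γ i : ℝ) + b i := by
    intro γ
    funext i
    simp only [c, b]
    field_simp
    ring
  simp only [harg] at hsum
  refine hsum.trans ((sum_mul_eq_of_mem_qspan (fun j hj => sum_residue_class_qpolyR hm ha
    (hcond j hj).1 (hcond j hj).2 α) (eval_affine_mem_qspan c b hπ)).trans ?_)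
  congr 2
  funext i
  simp only [c, b, σ, param, Finset.sum_range_succ]
  field_simp
  ring

theorem StepwiseReproduces.iterate {s : ℕ} {m : ℤ} {a : ZS s → ℝ} {τ : Fin s → ℝ} {k : ℕ}
    (h : StepwiseReproduces m a τ k) {π : MvPolynomial (Fin s) ℝ} (hπ : π.totalDegree ≤ k)
    (r : ℕ) :
    (subdOp m a)^[r] (fun α => MvPolynomial.eval (fun i => (α i : ℝ)) π)
      = fun α => MvPolynomial.eval (param m τ r α) π := by
  induction r with
  | zero =>
    funext α
    have hα : param m τ 0 α = fun i => (α i : ℝ) := by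
      funext i
      simp [param]
    rw [hα, Function.iterate_zero, id_eq]
  | succ r ih =>
    rw [Function.iterate_succ_apply', ih]
    exact funext (h π hπ r)

theorem StepwiseReproduces.reproduces {s : ℕ} {m : ℤ} {a : ZS s → ℝ} {τ : Fin s → ℝ} {k : ℕ}
    (h : StepwiseReproduces m a τ k) : Reproduces m a τ k := by
  intro π hπ
  refine ⟨fun _ x => MvPolynomial.eval x π, fun _ => MvPolynomial.continuous_eval π,
    fun r α => (congrFun (h.iterate hπ r) α).symm, ?_⟩
  exact fun u hu => Filter.Eventually.of_forall fun _ _ => refl_mem_uniformity hu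

/-- A convergent subdivision scheme with parametrization offset `τ` reproduces
polynomials of total degree up to `k` if `(D^j a)(1,…,1) = |m|^s q_j(τ)` and `(D^j a)(ε) = 0`
for all `ε ∈ Ξ'` and all `|j| ≤ k`. -/
theorem stmt9 {s : ℕ} (hs : 1 ≤ s) (m : ℤ) (hm : 2 ≤ |m|)
    (a : ZS s → ℝ) (ha : (Function.support a).Finite) (k : ℕ)
    (τ : Fin s → ℝ) (hconv : Convergent m a τ)
    (hcond : ∀ j : Fin s → ℕ, (∑ i, j i) ≤ k →
      symbolD a j onesC = ((|m| : ℤ) : ℂ) ^ s * qpolyC j (fun i => (τ i : ℂ)) ∧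
      ∀ e : ZS s, inE m e → e ≠ 0 → symbolD a j (epsPt m e) = 0) :
    Reproduces m a τ k :=
  (stepwiseReproduces_of_symbolD (by rintro rfl; simp at hm) ha hcond).reproduces

end
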